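/- With Λ_n the n×n Gram matrix of the pooled sample (entries K(X_i^{(j)}, X_{i'}^{(l)})), N_n the block-diagonal centering matrix with blocks Q_{n_j} = I_{n_j} − n_j^{-1}𝟏_{n_j}𝟏_{n_j}^T, and m_n^{(j)} ∈ ℝ^n the vector whose entry is n_j^{-1} − n^{-1} at positions belonging to the j-th sample block and −n^{-1} elsewhere, one has for each j: P_j·‖V̂_n^{-1/2} δ̂_j‖_H² = (n_j/(n γ_n))·[ (m_n^{(j)})^T Λ_n m_n^{(j)} − n^{-1}(m_n^{(j)})^T Λ_n N_n (γ_n I_n + n^{-1} N_n^T Λ_n N_n)^{-1} N_n^T Λ_n m_n^{(j)} ]. -/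

import Mathlib

open Finset Matrix
open scoped RealInnerProductSpace

noncomputable section

/-- The rank-one operator `(u ⊗ v) h = ⟨u, h⟩ v`. -/
def rankOne {H : Type*} [NormedAddCommGroup H] [InnerProductSpace ℝ H] (u v : H) :
    H →L[ℝ] H :=
  (innerSL ℝ u).smulRight v

/-- The covariance-type operator `c • ∑ₐ (N Nᵀ ⟪f, h⟫)ₐ fₐ + γ h` is inverted on the span of `f`
through its Gram matrix: the quadratic form of the inverse, in matrix terms. -/
theorem norm_sq_sqrt_inverse_linearCombination {H ι : Type*} [NormedAddCommGroup H]
    [InnerProductSpace ℝ H] [Fintype ι] [DecidableEq ι] (f : ι → H) (N : Matrix ι ι ℝ)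
    {c γ : ℝ} (hc : 0 ≤ c) (hγ : 0 < γ) (V R : H →L[ℝ] H)
    (hV : ∀ h, V h = c • Fintype.linearCombination ℝ f (N *ᵥ (Nᵀ *ᵥ fun a => ⟪f a, h⟫)) + γ • h)
    (hR : ∀ x y : H, ⟪R x, y⟫ = ⟪x, R y⟫) (hRV : R * R * V = 1) (m : ι → ℝ) :
    ‖R (Fintype.linearCombination ℝ f m)‖ ^ 2 =
      γ⁻¹ * (m ⬝ᵥ gram ℝ f *ᵥ m - c * (m ⬝ᵥ gram ℝ f *ᵥ (N *ᵥ
        ((γ • (1 : Matrix ι ι ℝ) + c • (Nᵀ * gram ℝ f * N))⁻¹ *ᵥ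
          (Nᵀ *ᵥ (gram ℝ f *ᵥ m)))))) := by
  set S := Fintype.linearCombination ℝ f with hS
  set M := γ • (1 : Matrix ι ι ℝ) + c • (Nᵀ * gram ℝ f * N) with hM
  set z := M⁻¹ *ᵥ (Nᵀ *ᵥ (gram ℝ f *ᵥ m)) with hz
  have hgram (w : ι → ℝ) : (fun a => ⟪f a, S w⟫) = gram ℝ f *ᵥ w := by
    ext a
    simp [hS, Fintype.linearCombination_apply, inner_sum, inner_smul_right, mulVec, dotProduct,
      gram_apply, mul_comm]
  have hinner (v w : ι → ℝ) : ⟪S v, S w⟫ = v ⬝ᵥ gram ℝ f *ᵥ w := by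
    rw [← hgram, hS, Fintype.linearCombination_apply, sum_inner]
    simp [dotProduct, inner_smul_left]
  have hMpos : M.PosDef := by
    refine (PosDef.one.smul hγ).add_posSemidef (PosSemidef.smul ?_ hc)
    simpa [conjTranspose_eq_transpose_of_trivial] using
      (posSemidef_gram ℝ f).conjTranspose_mul_mul_same N
  have hMz : γ • z + c • Nᵀ *ᵥ (gram ℝ f *ᵥ (N *ᵥ z)) = Nᵀ *ᵥ (gram ℝ f *ᵥ m) := by
    have : M *ᵥ z = Nᵀ *ᵥ (gram ℝ f *ᵥ m) := by
      rw [hz, mulVec_mulVec, mul_nonsing_inv _ ((isUnit_iff_isUnit_det _).1 hMpos.isUnit),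
        one_mulVec]
    simpa [hM, add_mulVec, smul_mulVec, ← mulVec_mulVec] using this
  have hVy : V (S m - c • S (N *ᵥ z)) = γ • S m := by
    rw [map_sub, map_smul, hV, hV, hgram, hgram, ← hMz]
    simp only [mulVec_add, mulVec_smul, map_add, map_smul]
    module
  have hRR : R (R (S m)) = γ⁻¹ • (S m - c • S (N *ᵥ z)) := by
    have h := congrArg (fun T : H →L[ℝ] H => T (S m - c • S (N *ᵥ z))) hRV
    simp only [mul_apply_eq_comp, one_apply_eq_self, hVy, map_smul] at h
    rw [← h, inv_smul_smul₀ hγ.ne']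
  rw [← real_inner_self_eq_norm_sq, hR, hRR]
  simp only [inner_smul_right, inner_sub_right, hinner]

section BlockCentering

variable {κ : Type*} [DecidableEq κ] (d : κ → ℕ)

/-- The block-diagonal matrix with blocks `I - d⁻¹ 𝟏 𝟏ᵀ`. -/
def blockCentering : Matrix ((l : κ) × Fin (d l)) ((l : κ) × Fin (d l)) ℝ :=
  Matrix.of fun a b => if a.1 = b.1 then (if a = b then 1 else 0) - ((d a.1 : ℝ))⁻¹ else 0

theorem blockCentering_transpose : (blockCentering d)ᵀ = blockCentering d := by
  ext a b
  by_cases h : a.1 = b.1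
  · simp [blockCentering, h, eq_comm]
  · simp [blockCentering, h, Ne.symm h]

variable [Fintype κ]

theorem blockCentering_mulVec (u : (l : κ) × Fin (d l) → ℝ) (l : κ) (i : Fin (d l)) :
    (blockCentering d *ᵥ u) ⟨l, i⟩ = u ⟨l, i⟩ - (d l : ℝ)⁻¹ * ∑ i', u ⟨l, i'⟩ := by
  rw [mulVec, dotProduct, Fintype.sum_sigma, Fintype.sum_eq_single l]
  · simp [blockCentering, sub_mul, Finset.sum_sub_distrib, Finset.mul_sum]
  · intro l' hl'
    simp [blockCentering, Ne.symm hl']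

theorem blockCentering_mulVec_mulVec (hd : ∀ l, 0 < d l) (u : (l : κ) × Fin (d l) → ℝ) :
    blockCentering d *ᵥ (blockCentering d *ᵥ u) = blockCentering d *ᵥ u := by
  ext ⟨l, i⟩
  have : (d l : ℝ) ≠ 0 := by exact_mod_cast (hd l).ne'
  simp only [blockCentering_mulVec, Finset.sum_sub_distrib, Finset.sum_const, Finset.card_univ,
    Fintype.card_fin, nsmul_eq_mul]
  field_simp
  ring

theorem linearCombination_blockCentering_mulVec {H : Type*} [AddCommGroup H] [Module ℝ H]
    (f : (l : κ) × Fin (d l) → H) (u : (l : κ) × Fin (d l) → ℝ) :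
    Fintype.linearCombination ℝ f (blockCentering d *ᵥ u) =
      ∑ l, (∑ i, u ⟨l, i⟩ • f ⟨l, i⟩ - ((d l : ℝ)⁻¹ * ∑ i, u ⟨l, i⟩) • ∑ i, f ⟨l, i⟩) := by
  simp only [Fintype.linearCombination_apply, Fintype.sum_sigma, blockCentering_mulVec, sub_smul,
    Finset.sum_sub_distrib, Finset.smul_sum]

end BlockCentering

/-- kernel trick for the regularized statistic.  With `Λ_n` the Gram matrix
of the pooled sample, `N_n` the block-diagonal centering matrix, `m_n^{(j)}` the coefficient
vector of `δ̂_j`, and `Rsq` a self-adjoint square root of `V̂_n⁻¹` (so that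
`‖V̂_n^{-1/2} δ̂_j‖² = ‖Rsq δ̂_j‖²`), one has for each `j`:
`P_j ‖V̂_n^{-1/2} δ̂_j‖² = (n_j/(n γ_n)) [ m_nᵀ Λ_n m_n − n⁻¹ m_nᵀ Λ_n N_n (γ_n I + n⁻¹ N_nᵀ Λ_n N_n)⁻¹ N_nᵀ Λ_n m_n ]`. -/
theorem kernel_trick_statistic
    {𝒳 H : Type*} [NormedAddCommGroup H] [InnerProductSpace ℝ H] [CompleteSpace H]
    (Φ : 𝒳 → H) {k : ℕ} (hk : 2 ≤ k)
    (nj : Fin k → ℕ) (hnj : ∀ j, 0 < nj j)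
    (X : (j : Fin k) → Fin (nj j) → 𝒳)
    (γ : ℝ) (hγ : 0 < γ) (j : Fin k) :
    letI n : ℕ := ∑ j', nj j'
    letI mhat : Fin k → H := fun j' => ((nj j' : ℝ))⁻¹ • ∑ i, Φ (X j' i)
    letI mbar : H := ∑ j', ((nj j' : ℝ) / (n : ℝ)) • mhat j'
    letI δhat : H := mhat j - mbar
    letI Vhat : Fin k → (H →L[ℝ] H) := fun j' =>
      ((nj j' : ℝ))⁻¹ • ∑ i, rankOne (Φ (X j' i)) (Φ (X j' i))
        - rankOne (mhat j') (mhat j')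
    letI What : H →L[ℝ] H := ∑ j', ((nj j' : ℝ) / (n : ℝ)) • Vhat j'
    letI Vn : H →L[ℝ] H := What + γ • (1 : H →L[ℝ] H)
    letI Lam : Matrix ((j' : Fin k) × Fin (nj j')) ((j' : Fin k) × Fin (nj j')) ℝ :=
      Matrix.of fun a b => ⟪Φ (X a.1 a.2), Φ (X b.1 b.2)⟫
    letI Nn : Matrix ((j' : Fin k) × Fin (nj j')) ((j' : Fin k) × Fin (nj j')) ℝ :=
      Matrix.of fun a b =>
        if a.1 = b.1 then (if a = b then 1 else 0) - ((nj a.1 : ℝ))⁻¹ else 0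
    letI mvec : (j' : Fin k) × Fin (nj j') → ℝ := fun a =>
      if a.1 = j then ((nj j : ℝ))⁻¹ - ((n : ℝ))⁻¹ else -((n : ℝ))⁻¹
    ∀ Rsq : H →L[ℝ] H, (∀ x y : H, ⟪Rsq x, y⟫ = ⟪x, Rsq y⟫) →
      Vn * (Rsq * Rsq) = 1 → (Rsq * Rsq) * Vn = 1 →
      ((nj j : ℝ) / (n : ℝ)) * ‖Rsq δhat‖ ^ 2
        = ((nj j : ℝ) / ((n : ℝ) * γ)) *
            (mvec ⬝ᵥ Lam.mulVec mvec
              - (n : ℝ)⁻¹ *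
                (mvec ⬝ᵥ Lam.mulVec (Nn.mulVec
                  ((γ • (1 : Matrix _ _ ℝ) + (n : ℝ)⁻¹ • (Nnᵀ * Lam * Nn))⁻¹.mulVec
                    (Nnᵀ.mulVec (Lam.mulVec mvec)))))) := by
  intro R hR _ hRV
  have hd (l : Fin k) : (nj l : ℝ) ≠ 0 := by exact_mod_cast (hnj l).ne'
  set n : ℕ := ∑ j', nj j' with hn
  have key := norm_sq_sqrt_inverse_linearCombination
    (fun a : (l : Fin k) × Fin (nj l) => Φ (X a.1 a.2)) (blockCentering nj)
    (c := (n : ℝ)⁻¹) (by positivity) hγ _ R ?_ hR hRV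
    (fun a => if a.1 = j then ((nj j : ℝ))⁻¹ - ((n : ℝ))⁻¹ else -((n : ℝ))⁻¹)
  · have hδ : Fintype.linearCombination ℝ (fun a : (l : Fin k) × Fin (nj l) => Φ (X a.1 a.2))
        (fun a => if a.1 = j then ((nj j : ℝ))⁻¹ - ((n : ℝ))⁻¹ else -((n : ℝ))⁻¹) =
        (nj j : ℝ)⁻¹ • ∑ i, Φ (X j i) -
          ∑ l, ((nj l : ℝ) / (n : ℝ)) • (nj l : ℝ)⁻¹ • ∑ i, Φ (X l i) := by
      have hcoef (l : Fin k) : (if l = j then ((nj j : ℝ))⁻¹ - ((n : ℝ))⁻¹ else -((n : ℝ))⁻¹) =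
          (if l = j then (nj j : ℝ)⁻¹ else 0) - (nj l : ℝ) / n * (nj l : ℝ)⁻¹ := by
        have := hd l
        split_ifs <;> field_simp <;> simp
      simp only [Fintype.linearCombination_apply, Fintype.sum_sigma, hcoef]
      simp [sub_smul, Finset.sum_sub_distrib, ite_smul, smul_smul, Finset.smul_sum]
    rw [hδ] at key
    refine (congrArg (fun t => (nj j : ℝ) / n * t) key).trans ?_
    rw [← mul_assoc, ← div_eq_mul_inv, div_div]
    rfl
  · intro h
    rw [blockCentering_transpose, blockCentering_mulVec_mulVec nj hnj,
      linearCombination_blockCentering_mulVec]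
    simp only [_root_.add_apply, _root_.sum_apply, _root_.smul_apply,
      _root_.sub_apply, one_apply_eq_self, rankOne,
      ContinuousLinearMap.smulRight_apply, innerSL_apply_apply, Finset.smul_sum (r := (n : ℝ)⁻¹)]
    congr 1
    refine Finset.sum_congr rfl fun l _ => ?_
    rw [real_inner_smul_left, sum_inner, smul_sub, smul_sub, smul_smul, smul_smul, smul_smul,
      smul_smul]
    have := hd l
    congr 2 <;> field_simp
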